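/- arXiv:2405.03249 — 2 statements merged into one kernel-verified Lean document; each statement's English description precedes it below -/
import Mathlib

section
/- Let φ: ℝ² → ℝ be a smooth (C⁴) function compactly supported in the open unit disk, and let f = dd⊥φ, i.e. f11 = -∂²φ/∂x1∂x2, f12 = (1/2)·(∂²φ/∂x1² - ∂²φ/∂x2²), f22 = ∂²φ/∂x1∂x2. Then for every x ∈ ℝ², φ(x) = (1/(2·u2))·∫_0^∞ Lf(x + s·e1) ds and φ(x) = -(1/(2·u2))·∫_0^∞ Tf(x + s·e1) ds. -/
open MeasureTheory

noncomputable section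

/-- Rotation of a vector by 90 degrees: `w⊥ = (-w2, w1)`. -/
def perp (w : ℝ × ℝ) : ℝ × ℝ := (-w.2, w.1)

/-- Divergent beam transform `X_w h (x) = ∫_0^∞ h(x + t w) dt`. -/
def Xray (w : ℝ × ℝ) (h : ℝ × ℝ → ℝ) (x : ℝ × ℝ) : ℝ :=
  ∫ t in Set.Ioi (0:ℝ), h (x + t • w)

/-- First moment divergent beam transform `X¹_w h (x) = ∫_0^∞ t·h(x + t w) dt`. -/
def Xray1 (w : ℝ × ℝ) (h : ℝ × ℝ → ℝ) (x : ℝ × ℝ) : ℝ :=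
  ∫ t in Set.Ioi (0:ℝ), t * h (x + t • w)

/-- Directional derivative `D_w h = w1 ∂h/∂x1 + w2 ∂h/∂x2`. -/
def Dw (w : ℝ × ℝ) (h : ℝ × ℝ → ℝ) (x : ℝ × ℝ) : ℝ :=
  fderiv ℝ h x w

/-- Partial derivative in the first coordinate. -/
def pdx (h : ℝ × ℝ → ℝ) : ℝ × ℝ → ℝ := Dw (1, 0) h

/-- Partial derivative in the second coordinate. -/
def pdy (h : ℝ × ℝ → ℝ) : ℝ × ℝ → ℝ := Dw (0, 1) h

/-- The open unit disk in ℝ². -/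
def unitDisk : Set (ℝ × ℝ) := {x | x.1 ^ 2 + x.2 ^ 2 < 1}

/-- `⟨f, w²⟩ = f11 w1² + 2 f12 w1 w2 + f22 w2²`. -/
def proj2 (f11 f12 f22 : ℝ × ℝ → ℝ) (w : ℝ × ℝ) (x : ℝ × ℝ) : ℝ :=
  f11 x * w.1 ^ 2 + 2 * f12 x * w.1 * w.2 + f22 x * w.2 ^ 2

/-- `⟨f, w ⊙ w⊥⟩ = -f11 w1 w2 + f12 (w1² - w2²) + f22 w1 w2`. -/
def projMix (f11 f12 f22 : ℝ × ℝ → ℝ) (w : ℝ × ℝ) (x : ℝ × ℝ) : ℝ :=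
  -(f11 x) * w.1 * w.2 + f12 x * (w.1 ^ 2 - w.2 ^ 2) + f22 x * w.1 * w.2

/-- V-line transform of a scalar function. -/
def Vlt (u v : ℝ × ℝ) (h : ℝ × ℝ → ℝ) (x : ℝ × ℝ) : ℝ := Xray u h x + Xray v h x

/-- Longitudinal V-line transform. -/
def Lf (u v : ℝ × ℝ) (f11 f12 f22 : ℝ × ℝ → ℝ) (x : ℝ × ℝ) : ℝ :=
  Xray u (proj2 f11 f12 f22 u) x + Xray v (proj2 f11 f12 f22 v) x

/-- Transverse V-line transform. -/
def Tf (u v : ℝ × ℝ) (f11 f12 f22 : ℝ × ℝ → ℝ) (x : ℝ × ℝ) : ℝ :=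
  Xray u (proj2 f11 f12 f22 (perp u)) x + Xray v (proj2 f11 f12 f22 (perp v)) x

/-- Mixed V-line transform. -/
def Mf (u v : ℝ × ℝ) (f11 f12 f22 : ℝ × ℝ → ℝ) (x : ℝ × ℝ) : ℝ :=
  Xray u (projMix f11 f12 f22 u) x + Xray v (projMix f11 f12 f22 v) x

/-- First moment longitudinal V-line transform. -/
def L1f (u v : ℝ × ℝ) (f11 f12 f22 : ℝ × ℝ → ℝ) (x : ℝ × ℝ) : ℝ :=
  Xray1 u (proj2 f11 f12 f22 u) x + Xray1 v (proj2 f11 f12 f22 v) x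

/-- The fundamental theorem of calculus along a ray, for compactly supported functions. -/
theorem Xray_Dw {g : ℝ × ℝ → ℝ} (hg : ContDiff ℝ 1 g) (hc : HasCompactSupport g)
    {w : ℝ × ℝ} (hw : w ≠ 0) (x : ℝ × ℝ) : Xray w (Dw w g) x = -g x := by
  have hray (t : ℝ) : HasDerivAt (fun t : ℝ => x + t • w) w t := by
    simpa using ((hasDerivAt_id t).smul_const w).const_add x
  have hder (t : ℝ) : HasDerivAt (fun t : ℝ => g (x + t • w)) (Dw w g (x + t • w)) t :=
    ((hg.differentiable one_ne_zero) _).hasFDerivAt.comp_hasDerivAt t (hray t)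
  have hemb : Topology.IsClosedEmbedding fun t : ℝ => x + t • w :=
    (Homeomorph.addLeft x).isClosedEmbedding.comp (isClosedEmbedding_smul_left hw)
  have hline : HasCompactSupport fun t : ℝ => g (x + t • w) := hc.comp_isClosedEmbedding hemb
  have hsmooth : ContDiff ℝ 1 fun t : ℝ => g (x + t • w) := by fun_prop
  have h := hline.integral_Ioi_deriv_eq hsmooth 0
  simpa [Xray, (hder _).deriv] using h

theorem contDiff_Dw {n : ℕ∞} {g : ℝ × ℝ → ℝ} (hg : ContDiff ℝ (n + 1) g) (w : ℝ × ℝ) :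
    ContDiff ℝ n (Dw w g) :=
  (hg.fderiv_right le_rfl).clm_apply contDiff_const

theorem hasCompactSupport_Dw {g : ℝ × ℝ → ℝ} (hc : HasCompactSupport g) (w : ℝ × ℝ) :
    HasCompactSupport (Dw w g) :=
  hc.fderiv_apply ℝ w

theorem Dw_Dw {g : ℝ × ℝ → ℝ} (hg : ContDiff ℝ 2 g) (w z x : ℝ × ℝ) :
    Dw w (Dw z g) x = fderiv ℝ (fderiv ℝ g) x w z := by
  have hd : DifferentiableAt ℝ (fderiv ℝ g) x :=
    (hg.fderiv_right (m := 1) le_rfl).differentiable one_ne_zero x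
  change fderiv ℝ (fun y => fderiv ℝ g y z) x w = _
  rw [fderiv_clm_apply hd (differentiableAt_const z)]
  simp

/-- The longitudinal part of `dd⊥φ` is `-D_w D_{w⊥} φ`. -/
theorem proj2_potential {φ : ℝ × ℝ → ℝ} (hφ : ContDiff ℝ 2 φ) (w : ℝ × ℝ) :
    proj2 (fun x => -(pdx (pdy φ) x)) (fun x => (1 / 2) * (pdx (pdx φ) x - pdy (pdy φ) x))
      (pdx (pdy φ)) w = Dw w (Dw (-perp w) φ) := by
  ext x
  obtain ⟨a, b⟩ := w
  have hsymm : fderiv ℝ (fderiv ℝ φ) x (0, 1) (1, 0) = fderiv ℝ (fderiv ℝ φ) x (1, 0) (0, 1) :=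
    (hφ.contDiffAt.isSymmSndFDerivAt (by simp)) _ _
  have hab : ((a, b) : ℝ × ℝ) = a • (1, 0) + b • (0, 1) := by simp
  have hperp : -perp (a, b) = b • ((1, 0) : ℝ × ℝ) - a • (0, 1) := by simp [perp]
  rw [Dw_Dw hφ, hperp, hab]
  simp only [proj2, pdx, pdy, Dw_Dw hφ, map_add, map_sub, map_smul,
    add_apply, smul_apply, smul_eq_mul, hsymm,
    Prod.fst_add, Prod.snd_add, Prod.smul_fst, Prod.smul_snd]
  ring

theorem proj2_perp_potential (p q : ℝ × ℝ → ℝ) (w : ℝ × ℝ) :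
    proj2 (fun x => -(p x)) q p (perp w) = -proj2 (fun x => -(p x)) q p w := by
  ext x
  simp only [proj2, perp, Pi.neg_apply]
  ring

theorem Xray_neg (w : ℝ × ℝ) (h : ℝ × ℝ → ℝ) (x : ℝ × ℝ) : Xray w (-h) x = -Xray w h x := by
  simp [Xray, integral_neg]

theorem Xray_const_mul (w : ℝ × ℝ) (c : ℝ) (h : ℝ × ℝ → ℝ) (x : ℝ × ℝ) :
    Xray w (fun y => c * h y) x = c * Xray w h x :=
  integral_const_mul _ _

theorem isBounded_unitDisk : Bornology.IsBounded unitDisk := by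
  refine Metric.isBounded_closedBall (x := (0 : ℝ × ℝ)) (r := 1) |>.subset fun x hx => ?_
  have hx : x.1 ^ 2 + x.2 ^ 2 < 1 := hx
  rw [mem_closedBall_zero_iff, Prod.norm_def, max_le_iff, Real.norm_eq_abs, Real.norm_eq_abs]
  exact ⟨abs_le_one_iff_mul_self_le_one.2 (by nlinarith),
    abs_le_one_iff_mul_self_le_one.2 (by nlinarith)⟩


theorem stmt_2 (u1 u2 : ℝ) (hu1 : 0 < u1) (hu2 : 0 < u2) (huv : u1 ^ 2 + u2 ^ 2 = 1)
    (φ : ℝ × ℝ → ℝ) (hφ : ContDiff ℝ 4 φ) (hφsupp : tsupport φ ⊆ unitDisk)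
    (f11 f12 f22 : ℝ × ℝ → ℝ)
    (hf11 : f11 = fun x => -(pdx (pdy φ) x))
    (hf12 : f12 = fun x => (1 / 2) * (pdx (pdx φ) x - pdy (pdy φ) x))
    (hf22 : f22 = pdx (pdy φ)) :
    ∀ x : ℝ × ℝ,
      φ x = (1 / (2 * u2)) * Xray (1, 0) (Lf (u1, u2) (-u1, u2) f11 f12 f22) x ∧
      φ x = -(1 / (2 * u2)) * Xray (1, 0) (Tf (u1, u2) (-u1, u2) f11 f12 f22) x := by
  intro x
  have hc : HasCompactSupport φ :=
    Metric.isCompact_of_isClosed_isBounded (isClosed_tsupport φ)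
      (isBounded_unitDisk.subset hφsupp)
  have hφ2 : ContDiff ℝ 2 φ := hφ.of_le (by norm_num)
  have hφ1 : ContDiff ℝ 1 φ := hφ.of_le (by norm_num)
  have hX (w : ℝ × ℝ) (hw : w ≠ 0) (y : ℝ × ℝ) :
      Xray w (proj2 f11 f12 f22 w) y = fderiv ℝ φ y (perp w) := by
    rw [hf11, hf12, hf22, proj2_potential hφ2,
      Xray_Dw (contDiff_Dw (n := 1) (by simpa [one_add_one_eq_two] using hφ2) _)
        (hasCompactSupport_Dw hc _) hw]
    simp [Dw]
  have hu : ((u1, u2) : ℝ × ℝ) ≠ 0 := by simp [hu1.ne']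
  have hv : ((-u1, u2) : ℝ × ℝ) ≠ 0 := by simp [hu1.ne']
  have hL : Lf (u1, u2) (-u1, u2) f11 f12 f22 = fun y => (-2 * u2) * Dw (1, 0) φ y := by
    ext y
    rw [Lf, hX _ hu, hX _ hv, ← map_add, Dw, ← smul_eq_mul, ← map_smul]
    congr 1
    ext <;> simp [perp]
    ring
  have hT : Tf (u1, u2) (-u1, u2) f11 f12 f22 = fun y => (2 * u2) * Dw (1, 0) φ y := by
    ext y
    have hLy := congrFun hL y
    rw [Lf] at hLy
    have hneg (w : ℝ × ℝ) : proj2 f11 f12 f22 (perp w) = -proj2 f11 f12 f22 w := by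
      rw [hf11, hf22, proj2_perp_potential]
    rw [Tf, hneg, hneg, Xray_neg, Xray_neg]
    linarith
  rw [hL, hT, Xray_const_mul, Xray_const_mul, Xray_Dw hφ1 hc (by simp)]
  constructor <;> field_simp
end
end

section
/- Let g = (g1,g2) be a vector field on ℝ² with smooth (C³) components compactly supported in the open unit disk, let f = d⊥g, i.e. f11 = -∂g1/∂x2, f12 = (1/2)·(∂g1/∂x1 - ∂g2/∂x2), f22 = ∂g2/∂x1, and set h̃(x) = -2·Mf(x) - V(∂g1/∂x1)(x). Then g2 satisfies, at every x ∈ ℝ², the second-order partial differential equation 2·u1²·∂²g2/∂x1²(x) + (u1² - u2²)·∂²g2/∂x2²(x) = -(1/(2·u2))·D_u D_v h̃(x). -/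
open MeasureTheory

noncomputable section

/-- A compactly supported function vanishes on far-away points of a line,
uniformly for nearby base points. -/
lemma exists_line_support {E : Type*} [NormedAddCommGroup E] {k : ℝ × ℝ → E}
    (hk : HasCompactSupport k) {w : ℝ × ℝ} (hw : w ≠ 0) (x : ℝ × ℝ) :
    ∃ T : ℝ, ∀ y ∈ Metric.ball x 1, ∀ t ∉ Set.Icc (-T) T, k (y + t • w) = 0 := by
  obtain ⟨R, hR⟩ := hk.isCompact.isBounded.exists_norm_le
  have hw' : 0 < ‖w‖ := norm_pos_iff.mpr hw
  refine ⟨(R + ‖x‖ + 1) / ‖w‖, fun y hy t ht => ?_⟩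
  by_contra hne
  apply ht
  rw [Set.mem_Icc, ← abs_le, le_div_iff₀ hw']
  have h1 : ‖y + t • w‖ ≤ R := hR _ (subset_tsupport _ hne)
  have h2 : ‖y - x‖ < 1 := by rwa [← dist_eq_norm]
  have h3 : ‖t • w‖ ≤ ‖y + t • w‖ + ‖y‖ := by
    simpa using norm_sub_le (y + t • w) y
  have h4 : ‖y‖ ≤ ‖y - x‖ + ‖x‖ := by simpa using norm_add_le (y - x) x
  rw [norm_smul, Real.norm_eq_abs] at h3
  linarith

/-- A continuous compactly supported function is dominated along lines by an integrable function,
uniformly for nearby base points. -/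
lemma exists_line_bound {E : Type*} [NormedAddCommGroup E] {k : ℝ × ℝ → E}
    (hk : HasCompactSupport k) (hc : Continuous k) {w : ℝ × ℝ} (hw : w ≠ 0) (x : ℝ × ℝ) :
    ∃ b : ℝ → ℝ, Integrable b ∧ ∀ y ∈ Metric.ball x 1, ∀ t, ‖k (y + t • w)‖ ≤ b t := by
  obtain ⟨T, hT⟩ := exists_line_support hk hw x
  obtain ⟨C, hC⟩ := hk.exists_bound_of_continuous hc
  refine ⟨(Set.Icc (-T) T).indicator fun _ => C,
    (integrable_indicator_iff measurableSet_Icc).mpr (integrableOn_const (by simp)),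
    fun y hy t => ?_⟩
  by_cases ht : t ∈ Set.Icc (-T) T
  · simpa [ht] using hC _
  · simp only [ht, hT y hy t ht, not_false_eq_true, Set.indicator_of_notMem, norm_zero, le_refl]

lemma integrable_line {E : Type*} [NormedAddCommGroup E] {k : ℝ × ℝ → E}
    (hk : HasCompactSupport k) (hc : Continuous k) {w : ℝ × ℝ} (hw : w ≠ 0) (x : ℝ × ℝ) :
    Integrable fun t : ℝ => k (x + t • w) := by
  obtain ⟨b, hb, hkb⟩ := exists_line_bound hk hc hw x
  exact hb.mono' (Continuous.aestronglyMeasurable (by fun_prop))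
    (.of_forall fun t => hkb x (by simp) t)

/-- Differentiation under the integral sign for the divergent beam transform. -/
lemma hasFDerivAt_Xray {h : ℝ × ℝ → ℝ} (hs : HasCompactSupport h) (hh : ContDiff ℝ 1 h)
    {w : ℝ × ℝ} (hw : w ≠ 0) (x : ℝ × ℝ) :
    HasFDerivAt (Xray w h) (∫ t in Set.Ioi (0 : ℝ), fderiv ℝ h (x + t • w)) x := by
  have hc : Continuous (fderiv ℝ h) := hh.continuous_fderiv (by norm_num)
  have hc0 : Continuous h := hh.continuous
  obtain ⟨b, hb, hkb⟩ := exists_line_bound (hs.fderiv ℝ) hc hw x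
  refine hasFDerivAt_integral_of_dominated_of_fderiv_le
    (F := fun y (t : ℝ) => h (y + t • w)) (F' := fun y (t : ℝ) => fderiv ℝ h (y + t • w))
    (Metric.ball_mem_nhds x one_pos)
    (.of_forall fun y => Continuous.aestronglyMeasurable (by fun_prop))
    (integrable_line hs hc0 hw x).restrict
    (Continuous.aestronglyMeasurable (by fun_prop))
    (.of_forall fun t y hy => hkb y hy t) hb.restrict
    (.of_forall fun t y _ => ?_)
  have hd := (hh.differentiable (by norm_num) (y + t • w)).hasFDerivAt
  simpa [Function.comp_def] using hd.comp y ((hasFDerivAt_id y).add_const (t • w))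

lemma differentiable_Xray {h : ℝ × ℝ → ℝ} (hs : HasCompactSupport h) (hh : ContDiff ℝ 1 h)
    {w : ℝ × ℝ} (hw : w ≠ 0) : Differentiable ℝ (Xray w h) :=
  fun x => (hasFDerivAt_Xray hs hh hw x).differentiableAt

lemma Dw_Xray {h : ℝ × ℝ → ℝ} (hs : HasCompactSupport h) (hh : ContDiff ℝ 1 h)
    {w : ℝ × ℝ} (hw : w ≠ 0) (z : ℝ × ℝ) : Dw z (Xray w h) = Xray w (Dw z h) := by
  ext x
  rw [Dw, (hasFDerivAt_Xray hs hh hw x).fderiv, ContinuousLinearMap.integral_apply]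
  · rfl
  · exact (integrable_line (hs.fderiv ℝ) (hh.continuous_fderiv (by norm_num)) hw x).restrict

/-- The fundamental theorem of calculus for the divergent beam transform. -/
lemma Xray_Dw_self {h : ℝ × ℝ → ℝ} (hs : HasCompactSupport h) (hh : ContDiff ℝ 1 h)
    {w : ℝ × ℝ} (hw : w ≠ 0) : Xray w (Dw w h) = -h := by
  ext x
  obtain ⟨T, hT⟩ := exists_line_support hs hw x
  have hd : deriv (fun t : ℝ => h (x + t • w)) = fun t => Dw w h (x + t • w) := by
    ext t
    have h1 := (hh.differentiable (by norm_num) (x + t • w)).hasFDerivAt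
    have h2 : HasDerivAt (fun t : ℝ => x + t • w) w t := by
      simpa using ((hasDerivAt_id t).smul_const w).const_add x
    exact (h1.comp_hasDerivAt t h2).deriv
  have hcs : HasCompactSupport fun t : ℝ => h (x + t • w) :=
    HasCompactSupport.intro isCompact_Icc (hT x (by simp))
  have := hcs.integral_Ioi_deriv_eq (by fun_prop) 0
  rw [hd] at this
  simpa [Xray] using this

lemma contDiff_Dw_s7 {n m : WithTop ℕ∞} {h : ℝ × ℝ → ℝ} (hh : ContDiff ℝ n h) (hmn : m + 1 ≤ n)
    (w : ℝ × ℝ) : ContDiff ℝ m (Dw w h) :=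
  (hh.fderiv_right hmn).clm_apply contDiff_const

lemma hasCompactSupport_Dw_s7 {h : ℝ × ℝ → ℝ} (hs : HasCompactSupport h) (w : ℝ × ℝ) :
    HasCompactSupport (Dw w h) :=
  hs.fderiv_apply ℝ w

lemma Dw_add {h k : ℝ × ℝ → ℝ} (hh : Differentiable ℝ h) (hk : Differentiable ℝ k)
    (w : ℝ × ℝ) : Dw w (h + k) = Dw w h + Dw w k := by
  ext x
  simp [Dw, fderiv_add (hh x) (hk x)]

lemma Dw_neg (h : ℝ × ℝ → ℝ) (w : ℝ × ℝ) : Dw w (-h) = -Dw w h := by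
  ext x
  simp [Dw, fderiv_neg]

lemma Dw_const_smul {h : ℝ × ℝ → ℝ} (hh : Differentiable ℝ h) (c : ℝ) (w : ℝ × ℝ) :
    Dw w (c • h) = c • Dw w h := by
  ext x
  simp [Dw, fderiv_const_smul (hh x) c]

lemma Dw_eq_pdx_pdy (h : ℝ × ℝ → ℝ) (w : ℝ × ℝ) :
    Dw w h = w.1 • pdx h + w.2 • pdy h := by
  ext x
  have hw : w = w.1 • ((1 : ℝ), (0 : ℝ)) + w.2 • ((0 : ℝ), (1 : ℝ)) := by ext <;> simp
  conv_lhs => rw [hw]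
  simp only [Dw, map_add, map_smul]
  rfl

lemma pdx_pdy_comm {h : ℝ × ℝ → ℝ} (hh : ContDiff ℝ 2 h) : pdx (pdy h) = pdy (pdx h) := by
  ext x
  have hd : DifferentiableAt ℝ (fderiv ℝ h) x :=
    (hh.fderiv_right (m := 1) (by norm_num)).differentiable (by norm_num) x
  have key (a b : ℝ × ℝ) : Dw a (Dw b h) x = fderiv ℝ (fderiv ℝ h) x a b := by
    change fderiv ℝ (fun y => fderiv ℝ h y b) x a = _
    rw [fderiv_clm_apply hd (differentiableAt_const b)]
    simp
  simp only [pdx, pdy, key]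
  exact (hh.contDiffAt.isSymmSndFDerivAt (by simp)) _ _

lemma Xray_add {h k : ℝ × ℝ → ℝ} (hh : HasCompactSupport h) (hhc : Continuous h)
    (hk : HasCompactSupport k) (hkc : Continuous k) {w : ℝ × ℝ} (hw : w ≠ 0) :
    Xray w (h + k) = Xray w h + Xray w k := by
  ext x
  exact integral_add (integrable_line hh hhc hw x).restrict (integrable_line hk hkc hw x).restrict

lemma Xray_const_smul (h : ℝ × ℝ → ℝ) (c : ℝ) (w : ℝ × ℝ) :
    Xray w (c • h) = c • Xray w h := by
  ext x
  exact integral_const_mul c _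

lemma hasCompactSupport_of_tsupport_subset_unitDisk {h : ℝ × ℝ → ℝ}
    (hs : tsupport h ⊆ unitDisk) : HasCompactSupport h := by
  refine HasCompactSupport.of_support_subset_isCompact
    (isCompact_closedBall (0 : ℝ × ℝ) 1) fun x hx => ?_
  have h1 : x.1 ^ 2 + x.2 ^ 2 < 1 := hs (subset_tsupport _ hx)
  simp only [mem_closedBall_zero_iff, Prod.norm_def, Real.norm_eq_abs, sup_le_iff]
  exact ⟨abs_le_one_iff_mul_self_le_one.mpr (by nlinarith),
    abs_le_one_iff_mul_self_le_one.mpr (by nlinarith)⟩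

/-- For `f = d⊥g` and a unit vector `w`, the integrand `2⟨f, w ⊙ w⊥⟩ + ∂g1/∂x1` is a derivative of
`g1` along `w` plus a first-order operator applied to `g2`. -/
lemma two_Xray_projMix_add_Xray_pdx {g1 g2 : ℝ × ℝ → ℝ}
    (hg1 : ContDiff ℝ 1 g1) (hg2 : ContDiff ℝ 1 g2)
    (hs1 : HasCompactSupport g1) (hs2 : HasCompactSupport g2)
    {w : ℝ × ℝ} (hw : w ≠ 0) (hw1 : w.1 ^ 2 + w.2 ^ 2 = 1) :
    (2 : ℝ) • Xray w (projMix (fun x => -(pdy g1 x))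
        (fun x => (1 / 2) * (pdx g1 x - pdy g2 x)) (pdx g2) w) + Xray w (pdx g1) =
      (-(2 * w.1)) • g1 + Xray w (Dw (2 * w.1 * w.2, w.2 ^ 2 - w.1 ^ 2) g2) := by
  have c1 (z) : Continuous (Dw z g1) :=
    (contDiff_Dw_s7 (m := 0) hg1 (by norm_num) z).continuous
  have c2 (z) : Continuous (Dw z g2) :=
    (contDiff_Dw_s7 (m := 0) hg2 (by norm_num) z).continuous
  have s1 (z) := hasCompactSupport_Dw_s7 hs1 z
  have s2 (z) := hasCompactSupport_Dw_s7 hs2 z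
  have hproj : projMix (fun x => -(pdy g1 x))
      (fun x => (1 / 2) * (pdx g1 x - pdy g2 x)) (pdx g2) w =
      (w.1 • Dw w g1 + (1 / 2 : ℝ) • Dw (2 * w.1 * w.2, w.2 ^ 2 - w.1 ^ 2) g2) +
        (-(1 / 2) : ℝ) • pdx g1 := by
    ext x
    simp only [projMix, Dw_eq_pdx_pdy, Pi.add_apply, Pi.smul_apply, smul_eq_mul]
    linear_combination (-(1 / 2) * pdx g1 x) * hw1
  have sw : HasCompactSupport (w.1 • Dw w g1) := (s1 w).smul_left (f := fun _ => w.1)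
  have sz : HasCompactSupport ((1 / 2 : ℝ) • Dw (2 * w.1 * w.2, w.2 ^ 2 - w.1 ^ 2) g2) :=
    (s2 _).smul_left (f := fun _ => (1 / 2 : ℝ))
  have sx : HasCompactSupport ((-(1 / 2) : ℝ) • pdx g1) :=
    (s1 _).smul_left (f := fun _ => (-(1 / 2) : ℝ))
  have cw := (c1 w).const_smul w.1
  have cz := (c2 (2 * w.1 * w.2, w.2 ^ 2 - w.1 ^ 2)).const_smul (1 / 2 : ℝ)
  have cx := (c1 (1, 0)).const_smul (-(1 / 2) : ℝ)
  rw [hproj, Xray_add (sw.add sz) (cw.add cz) sx cx hw, Xray_add sw cw sz cz hw,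
    Xray_const_smul, Xray_const_smul, Xray_const_smul, Xray_Dw_self hs1 hg1 hw]
  ext x
  simp only [Pi.add_apply, Pi.smul_apply, Pi.neg_apply, smul_eq_mul]
  ring

/-- Applying `D_u D_v` to `X_u h + X_v k` leaves only local terms. -/
lemma Dw_Dw_Xray_add_Xray {h k : ℝ × ℝ → ℝ} (hh : ContDiff ℝ 2 h) (hk : ContDiff ℝ 2 k)
    (hhs : HasCompactSupport h) (hks : HasCompactSupport k)
    {u v : ℝ × ℝ} (hu : u ≠ 0) (hv : v ≠ 0) :
    Dw u (Dw v (Xray u h + Xray v k)) = -(Dw v h + Dw u k) := by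
  have h1 : ContDiff ℝ 1 h := hh.of_le (by norm_num)
  have k1 : ContDiff ℝ 1 k := hk.of_le (by norm_num)
  have hv1 : ContDiff ℝ 1 (Dw v h) := contDiff_Dw_s7 hh (by norm_num) v
  have hvs := hasCompactSupport_Dw_s7 hhs v
  rw [Dw_add (differentiable_Xray hhs h1 hu) (differentiable_Xray hks k1 hv),
    Dw_Xray hhs h1 hu, Dw_Xray hks k1 hv, Xray_Dw_self hks k1 hv,
    Dw_add (differentiable_Xray hvs hv1 hu) (k1.differentiable (by norm_num)).neg,
    Dw_Xray hvs hv1 hu, Xray_Dw_self hvs hv1 hu, Dw_neg, neg_add]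

theorem stmt_7 (u1 u2 : ℝ) (hu1 : 0 < u1) (hu2 : 0 < u2) (huv : u1 ^ 2 + u2 ^ 2 = 1)
    (g1 g2 : ℝ × ℝ → ℝ) (hg1 : ContDiff ℝ 3 g1) (hg2 : ContDiff ℝ 3 g2)
    (hg1supp : tsupport g1 ⊆ unitDisk) (hg2supp : tsupport g2 ⊆ unitDisk)
    (f11 f12 f22 : ℝ × ℝ → ℝ)
    (hf11 : f11 = fun x => -(pdy g1 x))
    (hf12 : f12 = fun x => (1 / 2) * (pdx g1 x - pdy g2 x))
    (hf22 : f22 = pdx g2)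
    (ht : ℝ × ℝ → ℝ)
    (hht : ht = fun x => -(2 * Mf (u1, u2) (-u1, u2) f11 f12 f22 x) - Vlt (u1, u2) (-u1, u2) (pdx g1) x) :
    ∀ x : ℝ × ℝ,
      2 * u1 ^ 2 * pdx (pdx g2) x + (u1 ^ 2 - u2 ^ 2) * pdy (pdy g2) x =
        -(1 / (2 * u2)) * Dw (u1, u2) (Dw (-u1, u2) ht) x := by
  subst hf11 hf12 hf22
  intro x
  have hs1 := hasCompactSupport_of_tsupport_subset_unitDisk hg1supp
  have hs2 := hasCompactSupport_of_tsupport_subset_unitDisk hg2supp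
  have hu : (u1, u2) ≠ (0 : ℝ × ℝ) := fun h => hu2.ne' (congrArg Prod.snd h)
  have hv : (-u1, u2) ≠ (0 : ℝ × ℝ) := fun h => hu2.ne' (congrArg Prod.snd h)
  have hg1' : ContDiff ℝ 1 g1 := hg1.of_le (by norm_num)
  have hg2' : ContDiff ℝ 1 g2 := hg2.of_le (by norm_num)
  have eu := two_Xray_projMix_add_Xray_pdx hg1' hg2' hs1 hs2 hu huv
  have ev := two_Xray_projMix_add_Xray_pdx hg1' hg2' hs1 hs2 hv (by simpa using huv)
  have hht' : ht = -(Xray (u1, u2) (Dw (2 * u1 * u2, u2 ^ 2 - u1 ^ 2) g2) +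
      Xray (-u1, u2) (Dw (2 * (-u1) * u2, u2 ^ 2 - (-u1) ^ 2) g2)) := by
    ext y
    have eu' := congrFun eu y
    have ev' := congrFun ev y
    simp only [Pi.add_apply, Pi.smul_apply, smul_eq_mul] at eu' ev'
    simp only [hht, Mf, Vlt, Pi.neg_apply, Pi.add_apply]
    linear_combination -eu' - ev'
  have d2 (z) : ContDiff ℝ 2 (Dw z g2) := contDiff_Dw_s7 hg2 (by norm_num) z
  have dx : Differentiable ℝ (pdx g2) := (d2 _).differentiable (by norm_num)
  have dy : Differentiable ℝ (pdy g2) := (d2 _).differentiable (by norm_num)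
  have hexp (z w) : Dw z (Dw w g2) = w.1 • Dw z (pdx g2) + w.2 • Dw z (pdy g2) := by
    rw [Dw_eq_pdx_pdy g2 w, Dw_add (dx.const_smul _) (dy.const_smul _),
      Dw_const_smul dx, Dw_const_smul dy]
  rw [hht', Dw_neg, Dw_neg, Dw_Dw_Xray_add_Xray (d2 _) (d2 _)
    (hasCompactSupport_Dw_s7 hs2 _) (hasCompactSupport_Dw_s7 hs2 _) hu hv, hexp, hexp,
    Dw_eq_pdx_pdy (pdx g2), Dw_eq_pdx_pdy (pdy g2), Dw_eq_pdx_pdy (pdx g2),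
    Dw_eq_pdx_pdy (pdy g2), pdx_pdy_comm (hg2.of_le (by norm_num))]
  simp only [Pi.neg_apply, Pi.add_apply, Pi.smul_apply, smul_eq_mul]
  field_simp
  ring
end
end
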